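/- There exists a finite graph G that is P6-free, diamond-free, bull-free and K4-free with chromatic number exactly 4 (for instance, the Grötzsch graph, i.e., the Mycielskian of the 5-cycle, which is triangle-free and P6-free). Hence the bound 4 in the theorem that every (P6, diamond, bull, K4)-free graph is 4-colorable is tight. -/

import Mathlib

open SimpleGraph

/-- The disjoint union `P2 ∪ P3`, on 5 vertices: edges 01, 23, 34. -/
def p2p3 : SimpleGraph (Fin 5) :=
  SimpleGraph.fromEdgeSet {s(0, 1), s(2, 3), s(3, 4)}

/-- The diamond: `K4` minus the edge 02. -/
def diamond : SimpleGraph (Fin 4) :=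
  SimpleGraph.fromEdgeSet {s(0, 1), s(1, 2), s(2, 3), s(0, 3), s(1, 3)}

/-- The bull: vertices v1,...,v5 are 0,...,4; edges v1v2, v2v3, v3v4, v2v5, v3v5. -/
def bull : SimpleGraph (Fin 5) :=
  SimpleGraph.fromEdgeSet {s(0, 1), s(1, 2), s(2, 3), s(1, 4), s(2, 4)}

/-- `K4`, the complete graph on 4 vertices. -/
def K4 : SimpleGraph (Fin 4) := ⊤

/-- `G` contains no induced subgraph isomorphic to `H`
(graph embeddings are exactly induced copies). -/
def IndFree {α β : Type*} (H : SimpleGraph α) (G : SimpleGraph β) : Prop :=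
  ¬ Nonempty (H ↪g G)

/-- Neighbourhoods in the Grötzsch graph: `0, …, 4` is the 5-cycle, `5 + i` is the twin of `i`,
and `10` is the apex. -/
def grotzschNeighbors : Fin 11 → List (Fin 11) :=
  ![[1, 4, 6, 9], [0, 2, 5, 7], [1, 3, 6, 8], [2, 4, 7, 9], [0, 3, 5, 8],
    [1, 4, 10], [0, 2, 10], [1, 3, 10], [2, 4, 10], [0, 3, 10], [5, 6, 7, 8, 9]]

/-- The Grötzsch graph, the Mycielskian of the 5-cycle. -/
def grotzsch : SimpleGraph (Fin 11) where
  Adj i j := j ∈ grotzschNeighbors i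
  symm := ⟨by decide +kernel⟩
  loopless := ⟨by decide +kernel⟩

instance : DecidableRel grotzsch.Adj :=
  fun i j => inferInstanceAs (Decidable (j ∈ grotzschNeighbors i))

theorem grotzsch_triangle_free (a b c : Fin 11) :
    grotzsch.Adj a b → grotzsch.Adj b c → ¬ grotzsch.Adj a c := by
  revert a b c
  decide +kernel

theorem IndFree.of_triangle {α β : Type*} {H : SimpleGraph α} {G : SimpleGraph β}
    (hG : ∀ a b c, G.Adj a b → G.Adj b c → ¬ G.Adj a c) {x y z : α}
    (hxy : H.Adj x y) (hyz : H.Adj y z) (hxz : H.Adj x z) : IndFree H G :=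
  fun ⟨f⟩ => hG (f x) (f y) (f z) (f.map_adj_iff.2 hxy) (f.map_adj_iff.2 hyz)
    (f.map_adj_iff.2 hxz)

set_option synthInstance.maxHeartbeats 400000 in
set_option synthInstance.maxSize 2000 in
theorem grotzsch_no_induced_path :
    ∀ a b, grotzsch.Adj a b → ∀ c, grotzsch.Adj b c → c ≠ a → ¬ grotzsch.Adj a c →
    ∀ d, grotzsch.Adj c d → ¬ grotzsch.Adj a d → ¬ grotzsch.Adj b d →
    ∀ e, grotzsch.Adj d e → ¬ grotzsch.Adj a e → ¬ grotzsch.Adj b e → ¬ grotzsch.Adj c e →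
    ∀ f, grotzsch.Adj e f → ¬ grotzsch.Adj a f → ¬ grotzsch.Adj b f → ¬ grotzsch.Adj c f →
      grotzsch.Adj d f := by
  decide +kernel

theorem grotzsch_pathGraph_free : IndFree (pathGraph 6) grotzsch := by
  rintro ⟨f⟩
  have h (i j : Fin 6) : grotzsch.Adj (f i) (f j) ↔ i.val + 1 = j.val ∨ j.val + 1 = i.val := by
    rw [f.map_adj_iff, pathGraph_adj]
  have := grotzsch_no_induced_path (f 0) (f 1) (by simp [h]) (f 2) (by simp [h])
    (by simp [f.injective.eq_iff]) (by simp [h]) (f 3) (by simp [h]) (by simp [h]) (by simp [h])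
    (f 4) (by simp [h]) (by simp [h]) (by simp [h]) (by simp [h])
    (f 5) (by simp [h]) (by simp [h]) (by simp [h]) (by simp [h])
  simp [h] at this

theorem grotzsch_colorable : grotzsch.Colorable 4 :=
  ⟨Coloring.mk (![0, 1, 0, 1, 2, 0, 1, 0, 1, 2, 3] : Fin 11 → Fin 4) (by decide +kernel)⟩

set_option synthInstance.maxHeartbeats 400000 in
set_option synthInstance.maxSize 2000 in
theorem grotzsch_no_three_coloring :
    ∀ u₀ u₁ : Fin 3, u₀ ≠ u₁ → ∀ u₂, u₁ ≠ u₂ → ∀ u₃, u₂ ≠ u₃ → ∀ u₄, u₃ ≠ u₄ → u₄ ≠ u₀ →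
    ∀ w₀, w₀ ≠ u₁ → w₀ ≠ u₄ → ∀ w₁, w₁ ≠ u₀ → w₁ ≠ u₂ → ∀ w₂, w₂ ≠ u₁ → w₂ ≠ u₃ →
    ∀ w₃, w₃ ≠ u₂ → w₃ ≠ u₄ → ∀ w₄, w₄ ≠ u₀ → w₄ ≠ u₃ →
    ∀ z, z ≠ w₀ → z ≠ w₁ → z ≠ w₂ → z ≠ w₃ → z = w₄ := by
  decide +kernel

theorem grotzsch_not_colorable : ¬ grotzsch.Colorable 3 := by
  rintro ⟨c⟩
  have h (i j : Fin 11) (hij : grotzsch.Adj i j) : c i ≠ c j := c.valid hij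
  exact h 10 9 (by decide) (grotzsch_no_three_coloring
    (c 0) (c 1) (h _ _ (by decide)) (c 2) (h _ _ (by decide)) (c 3) (h _ _ (by decide))
    (c 4) (h _ _ (by decide)) (h _ _ (by decide))
    (c 5) (h _ _ (by decide)) (h _ _ (by decide)) (c 6) (h _ _ (by decide)) (h _ _ (by decide))
    (c 7) (h _ _ (by decide)) (h _ _ (by decide)) (c 8) (h _ _ (by decide)) (h _ _ (by decide))
    (c 9) (h _ _ (by decide)) (h _ _ (by decide)) (c 10) (h _ _ (by decide))
    (h _ _ (by decide)) (h _ _ (by decide)) (h _ _ (by decide)))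

theorem grotzsch_chromaticNumber : grotzsch.chromaticNumber = 4 :=
  chromaticNumber_eq_iff_colorable_not_colorable (n := 3) |>.2
    ⟨grotzsch_colorable, grotzsch_not_colorable⟩

/-- There is a finite (P6, diamond, bull, K4)-free graph with chromatic number
exactly 4, so the bound 4 is tight. -/
theorem stmt19 : ∃ (n : ℕ) (G : SimpleGraph (Fin n)),
    IndFree (pathGraph 6) G ∧ IndFree diamond G ∧ IndFree bull G ∧
    IndFree K4 G ∧ G.chromaticNumber = 4 := by
  refine ⟨11, grotzsch, grotzsch_pathGraph_free, ?_, ?_, ?_, grotzsch_chromaticNumber⟩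
  · exact .of_triangle grotzsch_triangle_free (x := 0) (y := 1) (z := 3)
      (by simp [diamond]) (by simp [diamond]) (by simp [diamond])
  · exact .of_triangle grotzsch_triangle_free (x := 1) (y := 2) (z := 4)
      (by simp [bull]) (by simp [bull]) (by simp [bull])
  · exact .of_triangle grotzsch_triangle_free (x := 0) (y := 1) (z := 2)
      (by simp [K4]) (by simp [K4]) (by simp [K4])
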